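/- Integration-by-parts identity for the Carleman cross terms: Let Q = (a,b) × (−T,T), let p_1, p_2 ∈ C¹([a,b]) and let φ be a C² function on the closure of Q. If w_1, w_2 are C² functions on the closure of Q vanishing at t = −T and t = T, then for every s ∈ ℝ: −∫_Q 2s p_2 (p_1 ∂_t w_1 + ∂_x w_2)(p_1 (∂_tφ) w_1 + (∂_xφ) w_2) dx dt − ∫_Q 2s p_1 (∂_x w_1 + p_2 ∂_t w_2)((∂_xφ) w_1 + p_2 (∂_tφ) w_2) dx dt = ∫_Q s [p_1² p_2 ∂_t²φ + ∂_x(p_1 ∂_xφ)] w_1² + s [p_1 p_2² ∂_t²φ + ∂_x(p_2 ∂_xφ)] w_2² dx dt + ∫_Q s [4 p_1 p_2 ∂_t∂_xφ + 2 (∂_x(p_1 p_2)) ∂_tφ] w_1 w_2 dx dt − ∫_Q ∂_x [ s (∂_xφ)(p_1 w_1² + p_2 w_2²) + 2 s p_1 p_2 (∂_tφ) w_1 w_2 ] dx dt. -/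

import Mathlib

open MeasureTheory

open Set Filter Topology

/-- A `Cⁿ` function on a closed rectangle, `n ≥ m + 1`, has partial derivatives in
the interior which extend to `Cᵐ` functions on the whole rectangle. -/
theorem exists_partial_derivs {a b c d : ℝ} (hab : a < b) (hcd : c < d) {m n : WithTop ℕ∞}
    (hmn : m + 1 ≤ n) {f : ℝ × ℝ → ℝ} (hf : ContDiffOn ℝ n f (Icc a b ×ˢ Icc c d)) :
    ∃ fx ft : ℝ × ℝ → ℝ,
      ContDiffOn ℝ m fx (Icc a b ×ˢ Icc c d) ∧ ContDiffOn ℝ m ft (Icc a b ×ˢ Icc c d) ∧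
      ∀ x ∈ Ioo a b, ∀ t ∈ Ioo c d,
        HasFDerivAt f (fx (x, t) • ContinuousLinearMap.fst ℝ ℝ ℝ
          + ft (x, t) • ContinuousLinearMap.snd ℝ ℝ ℝ) (x, t) := by
  have hK : UniqueDiffOn ℝ (Icc a b ×ˢ Icc c d) :=
    (uniqueDiffOn_Icc hab).prod (uniqueDiffOn_Icc hcd)
  have hf' := hf.fderivWithin hK hmn
  refine ⟨fun z => fderivWithin ℝ f (Icc a b ×ˢ Icc c d) z (1, 0),
    fun z => fderivWithin ℝ f (Icc a b ×ˢ Icc c d) z (0, 1),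
    hf'.clm_apply contDiffOn_const, hf'.clm_apply contDiffOn_const, fun x hx t ht => ?_⟩
  have hn : n ≠ 0 := fun h => by simp [h] at hmn
  have hmem : Icc a b ×ˢ Icc c d ∈ 𝓝 (x, t) :=
    prod_mem_nhds (Icc_mem_nhds hx.1 hx.2) (Icc_mem_nhds ht.1 ht.2)
  refine (((hf.differentiableOn hn) (x, t) (mem_of_mem_nhds hmem)).hasFDerivWithinAt.hasFDerivAt
    hmem).congr_fderiv ?_
  ext <;> simp

theorem HasFDerivAt.hasDerivAt_left {f : ℝ × ℝ → ℝ} {u v x t : ℝ}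
    (h : HasFDerivAt f (u • ContinuousLinearMap.fst ℝ ℝ ℝ + v • ContinuousLinearMap.snd ℝ ℝ ℝ)
      (x, t)) : HasDerivAt (fun y => f (y, t)) u x := by
  simpa [Function.comp_def] using
    h.comp_hasDerivAt x ((hasDerivAt_id x).prodMk (hasDerivAt_const x t))

theorem HasFDerivAt.hasDerivAt_right {f : ℝ × ℝ → ℝ} {u v x t : ℝ}
    (h : HasFDerivAt f (u • ContinuousLinearMap.fst ℝ ℝ ℝ + v • ContinuousLinearMap.snd ℝ ℝ ℝ)
      (x, t)) : HasDerivAt (fun τ => f (x, τ)) v t := by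
  simpa [Function.comp_def] using
    h.comp_hasDerivAt t ((hasDerivAt_const t x).prodMk (hasDerivAt_id t))

/-- Symmetry of the mixed second derivatives, in terms of partial derivatives. -/
theorem mixed_partial_derivs_eq {f fx ft : ℝ × ℝ → ℝ} {x t fxx fxt ftx ftt : ℝ}
    (hf : ∀ᶠ z in 𝓝 (x, t), HasFDerivAt f (fx z • ContinuousLinearMap.fst ℝ ℝ ℝ
      + ft z • ContinuousLinearMap.snd ℝ ℝ ℝ) z)
    (hfx : HasFDerivAt fx (fxx • ContinuousLinearMap.fst ℝ ℝ ℝ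
      + fxt • ContinuousLinearMap.snd ℝ ℝ ℝ) (x, t))
    (hft : HasFDerivAt ft (ftx • ContinuousLinearMap.fst ℝ ℝ ℝ
      + ftt • ContinuousLinearMap.snd ℝ ℝ ℝ) (x, t)) : ftx = fxt := by
  have h := second_derivative_symmetric_of_eventually hf
    ((hfx.smul_const (ContinuousLinearMap.fst ℝ ℝ ℝ)).add
      (hft.smul_const (ContinuousLinearMap.snd ℝ ℝ ℝ))) (1, 0) (0, 1)
  simpa using h

/-- An iterated integral over an open rectangle of a function agreeing there with a function
continuous on the closed rectangle is an integral over the product. -/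
theorem iterated_setIntegral_eq_setIntegral_prod {a b c d : ℝ} {F : ℝ → ℝ → ℝ} {G : ℝ × ℝ → ℝ}
    (hG : ContinuousOn G (Icc a b ×ˢ Icc c d))
    (hFG : ∀ x ∈ Ioo a b, ∀ t ∈ Ioo c d, F x t = G (x, t)) :
    ∫ x in Ioo a b, ∫ t in Ioo c d, F x t = ∫ z in Ioo a b ×ˢ Ioo c d, G z := by
  have hint : IntegrableOn G (Ioo a b ×ˢ Ioo c d) :=
    (hG.integrableOn_compact (isCompact_Icc.prod isCompact_Icc)).mono_set
      (prod_mono Ioo_subset_Icc_self Ioo_subset_Icc_self)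
  rw [Measure.volume_eq_prod] at hint ⊢
  rw [setIntegral_prod _ hint]
  exact setIntegral_congr_fun measurableSet_Ioo fun x hx =>
    setIntegral_congr_fun measurableSet_Ioo fun t ht => hFG x hx t ht

/-- The integral over a rectangle of a `t`-derivative of a function vanishing on the horizontal
sides is zero. -/
theorem setIntegral_prod_eq_zero_of_hasDerivAt {a b c d : ℝ} (hcd : c ≤ d) {G H : ℝ × ℝ → ℝ}
    (hG : ContinuousOn G (Icc a b ×ˢ Icc c d)) (hH : ContinuousOn H (Icc a b ×ˢ Icc c d))
    (hderiv : ∀ x ∈ Ioo a b, ∀ t ∈ Ioo c d, HasDerivAt (fun τ => G (x, τ)) (H (x, t)) t)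
    (hc : ∀ x ∈ Ioo a b, G (x, c) = 0) (hd : ∀ x ∈ Ioo a b, G (x, d) = 0) :
    ∫ z in Ioo a b ×ˢ Ioo c d, H z = 0 := by
  rw [← iterated_setIntegral_eq_setIntegral_prod (F := fun x t => H (x, t)) hH
    fun _ _ _ _ => rfl]
  refine setIntegral_eq_zero_of_forall_eq_zero fun x hx => ?_
  have hslice : MapsTo (fun t => (x, t)) (Icc c d) (Icc a b ×ˢ Icc c d) :=
    fun t ht => ⟨Ioo_subset_Icc_self hx, ht⟩
  have hHx : ContinuousOn (fun t => H (x, t)) (Icc c d) :=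
    hH.comp (by fun_prop) hslice
  rw [← integral_Ioc_eq_integral_Ioo, ← intervalIntegral.integral_of_le hcd,
    intervalIntegral.integral_eq_sub_of_hasDerivAt_of_le hcd (hG.comp (by fun_prop) hslice)
      (hderiv x hx) (hHx.intervalIntegrable_of_Icc hcd)]
  simp [hc x hx, hd x hx]


/-- **Integration-by-parts identity for the Carleman cross terms.**
Let `Q = (a,b) × (−T,T)`, let `p₁, p₂ ∈ C¹([a,b])` and let `φ` be a `C²` function on the
closure of `Q`.  If `w₁, w₂` are `C²` functions on the closure of `Q` vanishing at `t = ±T`,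
then for every `s ∈ ℝ` the two cross terms of the Carleman estimate equal the sum of the
zeroth-order terms plus a pure `x`-divergence. -/
theorem carleman_cross_terms_integration_by_parts
    (a b T : ℝ) (hab : a < b) (hT : 0 < T)
    (p1 p2 : ℝ → ℝ)
    (hp1 : ContDiffOn ℝ 1 p1 (Set.Icc a b))
    (hp2 : ContDiffOn ℝ 1 p2 (Set.Icc a b))
    (φ w1 w2 : ℝ → ℝ → ℝ)
    (hφ : ContDiffOn ℝ 2 (fun z : ℝ × ℝ => φ z.1 z.2) (Set.Icc a b ×ˢ Set.Icc (-T) T))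
    (hw1 : ContDiffOn ℝ 2 (fun z : ℝ × ℝ => w1 z.1 z.2) (Set.Icc a b ×ˢ Set.Icc (-T) T))
    (hw2 : ContDiffOn ℝ 2 (fun z : ℝ × ℝ => w2 z.1 z.2) (Set.Icc a b ×ˢ Set.Icc (-T) T))
    (hw1T : ∀ x ∈ Set.Icc a b, w1 x (-T) = 0 ∧ w1 x T = 0)
    (hw2T : ∀ x ∈ Set.Icc a b, w2 x (-T) = 0 ∧ w2 x T = 0) :
    ∀ s : ℝ,
      (-(∫ x in Set.Ioo a b, ∫ t in Set.Ioo (-T) T,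
          2 * s * p2 x * (p1 x * deriv (w1 x) t + deriv (fun y => w2 y t) x)
            * (p1 x * deriv (φ x) t * w1 x t + deriv (fun y => φ y t) x * w2 x t)))
        - (∫ x in Set.Ioo a b, ∫ t in Set.Ioo (-T) T,
            2 * s * p1 x * (deriv (fun y => w1 y t) x + p2 x * deriv (w2 x) t)
              * (deriv (fun y => φ y t) x * w1 x t + p2 x * deriv (φ x) t * w2 x t))
      = (∫ x in Set.Ioo a b, ∫ t in Set.Ioo (-T) T,
            s * ((p1 x) ^ 2 * p2 x * iteratedDeriv 2 (φ x) t
                + deriv (fun y => p1 y * deriv (fun z => φ z t) y) x) * (w1 x t) ^ 2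
              + s * (p1 x * (p2 x) ^ 2 * iteratedDeriv 2 (φ x) t
                + deriv (fun y => p2 y * deriv (fun z => φ z t) y) x) * (w2 x t) ^ 2)
        + (∫ x in Set.Ioo a b, ∫ t in Set.Ioo (-T) T,
            s * (4 * p1 x * p2 x * deriv (fun τ => deriv (fun y => φ y τ) x) t
                + 2 * deriv (fun y => p1 y * p2 y) x * deriv (φ x) t)
              * w1 x t * w2 x t)
        - (∫ x in Set.Ioo a b, ∫ t in Set.Ioo (-T) T,
            deriv (fun y =>
              s * deriv (fun z => φ z t) y * (p1 y * (w1 y t) ^ 2 + p2 y * (w2 y t) ^ 2)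
                + 2 * s * p1 y * p2 y * deriv (φ y) t * (w1 y t) * (w2 y t)) x) := by
  intro s
  obtain ⟨φ, rfl⟩ : ∃ f : ℝ × ℝ → ℝ, φ = fun x t => f (x, t) := ⟨fun z => φ z.1 z.2, rfl⟩
  obtain ⟨w1, rfl⟩ : ∃ f : ℝ × ℝ → ℝ, w1 = fun x t => f (x, t) := ⟨fun z => w1 z.1 z.2, rfl⟩
  obtain ⟨w2, rfl⟩ : ∃ f : ℝ × ℝ → ℝ, w2 = fun x t => f (x, t) := ⟨fun z => w2 z.1 z.2, rfl⟩
  simp only [Prod.mk.eta] at hφ hw1 hw2 hw1T hw2T ⊢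
  have hT' : -T < T := by linarith
  obtain ⟨φx, φt, cφx, cφt, dφ⟩ := exists_partial_derivs hab hT' (m := 1) one_add_one_eq_two.le hφ
  obtain ⟨φxx, φxt, cφxx, cφxt, dφx⟩ :=
    exists_partial_derivs hab hT' (m := 0) (zero_add 1).le cφx
  obtain ⟨φtx, φtt, -, cφtt, dφt⟩ :=
    exists_partial_derivs hab hT' (m := 0) (zero_add 1).le cφt
  obtain ⟨w1x, w1t, cw1x, cw1t, dw1⟩ :=
    exists_partial_derivs hab hT' (m := 1) one_add_one_eq_two.le hw1
  obtain ⟨w2x, w2t, cw2x, cw2t, dw2⟩ :=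
    exists_partial_derivs hab hT' (m := 1) one_add_one_eq_two.le hw2
  have hsymm : ∀ x ∈ Ioo a b, ∀ t ∈ Ioo (-T) T, φtx (x, t) = φxt (x, t) := fun x hx t ht =>
    mixed_partial_derivs_eq
      (Filter.eventually_of_mem (prod_mem_nhds (Ioo_mem_nhds hx.1 hx.2) (Ioo_mem_nhds ht.1 ht.2))
        fun z hz => dφ z.1 hz.1 z.2 hz.2) (dφx x hx t ht) (dφt x hx t ht)
  have exists_lift : ∀ {p : ℝ → ℝ}, ContDiffOn ℝ 1 p (Icc a b) → ∃ P Q : ℝ × ℝ → ℝ,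
      ContinuousOn P (Icc a b ×ˢ Icc (-T) T) ∧ ContinuousOn Q (Icc a b ×ˢ Icc (-T) T) ∧
      (∀ x t, P (x, t) = p x) ∧ ∀ x ∈ Ioo a b, ∀ t, HasDerivAt p (Q (x, t)) x := fun {p} hp =>
    ⟨fun z => p z.1, fun z => derivWithin p (Icc a b) z.1,
      hp.continuousOn.comp continuousOn_fst fun z hz => hz.1,
      (hp.continuousOn_derivWithin (uniqueDiffOn_Icc hab) le_rfl).comp continuousOn_fst
        fun z hz => hz.1,
      fun _ _ => rfl,
      fun x hx _ => ((hp.differentiableOn one_ne_zero) x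
        (Ioo_subset_Icc_self hx)).hasDerivWithinAt.hasDerivAt (Icc_mem_nhds hx.1 hx.2)⟩
  obtain ⟨P1, Q1, cP1, cQ1, eP1, dp1⟩ := exists_lift hp1
  obtain ⟨P2, Q2, cP2, cQ2, eP2, dp2⟩ := exists_lift hp2
  replace hw1 := hw1.continuousOn
  replace hw2 := hw2.continuousOn
  replace cφx := cφx.continuousOn
  replace cφt := cφt.continuousOn
  replace cφxx := cφxx.continuousOn
  replace cφxt := cφxt.continuousOn
  replace cφtt := cφtt.continuousOn
  replace cw1x := cw1x.continuousOn
  replace cw1t := cw1t.continuousOn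
  replace cw2x := cw2x.continuousOn
  replace cw2t := cw2t.continuousOn
  have eφx : ∀ x ∈ Ioo a b, ∀ t ∈ Ioo (-T) T, deriv (fun y => φ (y, t)) x = φx (x, t) :=
    fun x hx t ht => (dφ x hx t ht).hasDerivAt_left.deriv
  have eφt : ∀ x ∈ Ioo a b, ∀ t ∈ Ioo (-T) T, deriv (fun τ => φ (x, τ)) t = φt (x, t) :=
    fun x hx t ht => (dφ x hx t ht).hasDerivAt_right.deriv
  have ew1x : ∀ x ∈ Ioo a b, ∀ t ∈ Ioo (-T) T, deriv (fun y => w1 (y, t)) x = w1x (x, t) :=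
    fun x hx t ht => (dw1 x hx t ht).hasDerivAt_left.deriv
  have ew1t : ∀ x ∈ Ioo a b, ∀ t ∈ Ioo (-T) T, deriv (fun τ => w1 (x, τ)) t = w1t (x, t) :=
    fun x hx t ht => (dw1 x hx t ht).hasDerivAt_right.deriv
  have ew2x : ∀ x ∈ Ioo a b, ∀ t ∈ Ioo (-T) T, deriv (fun y => w2 (y, t)) x = w2x (x, t) :=
    fun x hx t ht => (dw2 x hx t ht).hasDerivAt_left.deriv
  have ew2t : ∀ x ∈ Ioo a b, ∀ t ∈ Ioo (-T) T, deriv (fun τ => w2 (x, τ)) t = w2t (x, t) :=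
    fun x hx t ht => (dw2 x hx t ht).hasDerivAt_right.deriv
  have dφxx : ∀ x ∈ Ioo a b, ∀ t ∈ Ioo (-T) T,
      HasDerivAt (fun y => deriv (fun z => φ (z, t)) y) (φxx (x, t)) x := fun x hx t ht =>
    (dφx x hx t ht).hasDerivAt_left.congr_of_eventuallyEq
      (Filter.eventually_of_mem (Ioo_mem_nhds hx.1 hx.2) fun y hy => eφx y hy t ht)
  have dφtx : ∀ x ∈ Ioo a b, ∀ t ∈ Ioo (-T) T,
      HasDerivAt (fun y => deriv (fun τ => φ (y, τ)) t) (φxt (x, t)) x := fun x hx t ht =>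
    hsymm x hx t ht ▸ (dφt x hx t ht).hasDerivAt_left.congr_of_eventuallyEq
      (Filter.eventually_of_mem (Ioo_mem_nhds hx.1 hx.2) fun y hy => eφt y hy t ht)
  have eφxt : ∀ x ∈ Ioo a b, ∀ t ∈ Ioo (-T) T,
      deriv (fun τ => deriv (fun y => φ (y, τ)) x) t = φxt (x, t) := fun x hx t ht =>
    ((dφx x hx t ht).hasDerivAt_right.congr_of_eventuallyEq
      (Filter.eventually_of_mem (Ioo_mem_nhds ht.1 ht.2) fun τ hτ => eφx x hx τ hτ)).deriv
  have eφtt : ∀ x ∈ Ioo a b, ∀ t ∈ Ioo (-T) T, iteratedDeriv 2 (fun τ => φ (x, τ)) t = φtt (x, t) :=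
    fun x hx t ht => by
    rw [iteratedDeriv_succ, iteratedDeriv_one]
    exact ((dφt x hx t ht).hasDerivAt_right.congr_of_eventuallyEq
      (Filter.eventually_of_mem (Ioo_mem_nhds ht.1 ht.2) fun τ hτ => eφt x hx τ hτ)).deriv
  rw [iterated_setIntegral_eq_setIntegral_prod
      (G := fun z => 2 * s * P2 z * (P1 z * w1t z + w2x z)
        * (P1 z * φt z * w1 z + φx z * w2 z)) (by fun_prop)
      fun x hx t ht => by
        simp only [eP1, eP2]
        rw [ew1t x hx t ht, ew2x x hx t ht, eφt x hx t ht, eφx x hx t ht],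
    iterated_setIntegral_eq_setIntegral_prod
      (G := fun z => 2 * s * P1 z * (w1x z + P2 z * w2t z)
        * (φx z * w1 z + P2 z * φt z * w2 z)) (by fun_prop)
      fun x hx t ht => by
        simp only [eP1, eP2]
        rw [ew1x x hx t ht, ew2t x hx t ht, eφt x hx t ht, eφx x hx t ht],
    iterated_setIntegral_eq_setIntegral_prod
      (G := fun z => s * (P1 z ^ 2 * P2 z * φtt z + (Q1 z * φx z + P1 z * φxx z))
          * w1 z ^ 2
        + s * (P1 z * P2 z ^ 2 * φtt z + (Q2 z * φx z + P2 z * φxx z))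
          * w2 z ^ 2) (by fun_prop)
      fun x hx t ht => by
        simp only [eP1, eP2]
        rw [eφtt x hx t ht, ((dp1 x hx t).fun_mul (dφxx x hx t ht)).deriv,
          ((dp2 x hx t).fun_mul (dφxx x hx t ht)).deriv, eφx x hx t ht],
    iterated_setIntegral_eq_setIntegral_prod
      (G := fun z => s * (4 * P1 z * P2 z * φxt z
        + 2 * (Q1 z * P2 z + P1 z * Q2 z) * φt z) * w1 z * w2 z)
      (by fun_prop)
      fun x hx t ht => by
        simp only [eP1, eP2]
        rw [eφxt x hx t ht, ((dp1 x hx t).fun_mul (dp2 x hx t)).deriv, eφt x hx t ht],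
    iterated_setIntegral_eq_setIntegral_prod
      (G := fun z => s * φxx z * (P1 z * w1 z ^ 2 + P2 z * w2 z ^ 2)
        + s * φx z * (Q1 z * w1 z ^ 2 + P1 z * (2 * w1 z * w1x z)
          + (Q2 z * w2 z ^ 2 + P2 z * (2 * w2 z * w2x z)))
        + 2 * s * ((Q1 z * P2 z + P1 z * Q2 z) * φt z * w1 z * w2 z
          + P1 z * P2 z * (φxt z * w1 z * w2 z
            + φt z * w1x z * w2 z + φt z * w1 z * w2x z))) (by fun_prop)
      fun x hx t ht => by
        have d1 := (dw1 x hx t ht).hasDerivAt_left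
        have d2 := (dw2 x hx t ht).hasDerivAt_left
        refine ((((dφxx x hx t ht).const_mul s).fun_mul
          (((dp1 x hx t).fun_mul (d1.fun_pow 2)).fun_add
            ((dp2 x hx t).fun_mul (d2.fun_pow 2)))).fun_add
          ((((((dp1 x hx t).const_mul (2 * s)).fun_mul (dp2 x hx t)).fun_mul
            (dφtx x hx t ht)).fun_mul d1).fun_mul d2)).deriv.trans ?_
        rw [eφx x hx t ht, eφt x hx t ht]
        simp only [eP1, eP2]
        push_cast
        ring]
  have hint : ∀ {G : ℝ × ℝ → ℝ}, ContinuousOn G (Icc a b ×ˢ Icc (-T) T) →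
      IntegrableOn G (Ioo a b ×ˢ Ioo (-T) T) := fun hG =>
    (hG.integrableOn_compact (isCompact_Icc.prod isCompact_Icc)).mono_set
      (prod_mono Ioo_subset_Icc_self Ioo_subset_Icc_self)
  have hzero := setIntegral_prod_eq_zero_of_hasDerivAt (a := a) (b := b) hT'.le
    (G := fun z => s * P1 z ^ 2 * P2 z * (φt z * w1 z ^ 2)
      + s * P1 z * P2 z ^ 2 * (φt z * w2 z ^ 2)
      + 2 * s * P1 z * P2 z * (φx z * w1 z * w2 z))
    (H := fun z => s * P1 z ^ 2 * P2 z
        * (φtt z * w1 z ^ 2 + φt z * (2 * w1 z * w1t z))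
      + s * P1 z * P2 z ^ 2 * (φtt z * w2 z ^ 2 + φt z * (2 * w2 z * w2t z))
      + 2 * s * P1 z * P2 z * (φxt z * w1 z * w2 z
        + φx z * w1t z * w2 z + φx z * w1 z * w2t z))
    (by fun_prop) (by fun_prop)
    (fun x hx t ht => by
      have d1 := (dw1 x hx t ht).hasDerivAt_right
      have d2 := (dw2 x hx t ht).hasDerivAt_right
      have dt := (dφt x hx t ht).hasDerivAt_right
      have dx := (dφx x hx t ht).hasDerivAt_right
      simp only [eP1, eP2]
      refine ((((dt.fun_mul (d1.fun_pow 2)).const_mul (s * p1 x ^ 2 * p2 x)).fun_add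
        ((dt.fun_mul (d2.fun_pow 2)).const_mul (s * p1 x * p2 x ^ 2))).fun_add
        (((dx.fun_mul d1).fun_mul d2).const_mul (2 * s * p1 x * p2 x))).congr_deriv ?_
      push_cast
      ring)
    (fun x hx => by
      simp [(hw1T x (Ioo_subset_Icc_self hx)).1, (hw2T x (Ioo_subset_Icc_self hx)).1])
    (fun x hx => by
      simp [(hw1T x (Ioo_subset_Icc_self hx)).2, (hw2T x (Ioo_subset_Icc_self hx)).2])
  rw [← integral_neg, ← integral_sub (hint (by fun_prop)) (hint (by fun_prop)),
    ← integral_add (hint (by fun_prop)) (hint (by fun_prop)),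
    ← integral_sub (hint (by fun_prop)) (hint (by fun_prop)), ← sub_eq_zero,
    ← integral_sub (hint (by fun_prop)) (hint (by fun_prop)), ← neg_eq_zero, ← integral_neg,
    ← hzero]
  congr 1
  ext z
  ring
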